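/- Let n ≥ 1, let X, Y, Z be pairwise disjoint finite sets each of size n, let 𝒰 = X ∪ Y ∪ Z, and let 𝒮 be a finite family of subsets of 𝒰 with |S ∩ X| = |S ∩ Y| = |S ∩ Z| = 1 for each S ∈ 𝒮; write m = |𝒮|. Let N consist of a player a_S for each S ∈ 𝒮, a player b_u for each u ∈ 𝒰, and one further player c, and let `beats` be the relation of any strict total order on N (so the strength graph is a complete DAG) in which c beats every other player and every a_S beats every b_u. Define pair values f by f(c, a_S) = 1 for every S ∈ 𝒮, f(a_S, b_u) = 1 whenever u ∈ S, and f = 0 on all other pairs. Then there exists a seeding σ with pair-based tournament value V(σ) ≥ m + 2n + 1 if and only if there exists 𝒮' ⊆ 𝒮 with |𝒮'| = n such that every element of 𝒰 lies in exactly one member of 𝒮'. -/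

import Mathlib

open Finset

noncomputable section
open scoped Classical

variable {P : Type*}

/-- The list of (winner, loser) pairs of the matches played in a Challenge the Champ
tournament whose current champ is `c` and whose remaining challengers, in order, are
the given list. -/
def ctcMatches (beats : P → P → Prop) : P → List P → List (P × P)
  | _, [] => []
  | c, x :: xs =>
    if beats c x then (c, x) :: ctcMatches beats c xs
    else (x, c) :: ctcMatches beats x xs

/-- The final champ of a Challenge the Champ tournament whose current champ is `c` and
whose remaining challengers, in order, are the given list. -/
def ctcChamp (beats : P → P → Prop) : P → List P → P
  | c, [] => c
  | c, x :: xs => if beats c x then ctcChamp beats c xs else ctcChamp beats x xs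

/-- The (winner, loser) pairs of matches of a Challenge the Champ tournament whose
seeding is given as a list of players. -/
def ctcMatchesL (beats : P → P → Prop) : List P → List (P × P)
  | [] => []
  | c :: xs => ctcMatches beats c xs

/-- The winner of a Challenge the Champ tournament seeded by a list of players. -/
def ctcWinnerL (beats : P → P → Prop) : List P → Option P
  | [] => none
  | c :: xs => some (ctcChamp beats c xs)

/-- The (winner, loser) pairs of the matches played under the seeding `σ`. -/
def matchesOf (beats : P → P → Prop) {n : ℕ} (σ : Fin n → P) : List (P × P) :=
  ctcMatchesL beats (List.ofFn σ)

/-- The winner of the Challenge the Champ tournament under the seeding `σ`. -/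
def winnerOf (beats : P → P → Prop) {n : ℕ} (σ : Fin n → P) : Option P :=
  ctcWinnerL beats (List.ofFn σ)

/-- `M_i(σ)`: the set of players who play a match against `i` and lose it. -/
def Mset [Fintype P] (beats : P → P → Prop) {n : ℕ} (σ : Fin n → P) (i : P) : Finset P :=
  univ.filter fun j => (i, j) ∈ matchesOf beats σ

/-- `w_i(σ)`: the number of matches won by player `i`. -/
def wins [Fintype P] (beats : P → P → Prop) {n : ℕ} (σ : Fin n → P) (i : P) : ℕ :=
  (Mset beats σ i).card

/-- The player-popularity-based tournament value of a seeding: each match contributes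
the popularity of its winner. -/
def Vpop [Fintype P] (beats : P → P → Prop) {n : ℕ} (σ : Fin n → P) (p : P → ℕ) : ℕ :=
  ∑ i, p i * wins beats σ i

/-- The pair values of the reduction of Theorem `stmt_15`: a match between `c`
(the `Sum.inr ()` player) and a set player `a_S` has value 1; a match between a set
player `a_S` and an element player `b_u` has value 1 iff `u ∈ S`; all other
matches have value 0. -/
def pairValue3DM {α : Type*} [DecidableEq α] (U : Finset α) (S : Finset (Finset α)) :
    (({s // s ∈ S} ⊕ {a // a ∈ U}) ⊕ Unit) →
    (({s // s ∈ S} ⊕ {a // a ∈ U}) ⊕ Unit) → ℕ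
  | Sum.inr _, Sum.inl (Sum.inl _) => 1
  | Sum.inl (Sum.inl s), Sum.inl (Sum.inr a) =>
      if (a : α) ∈ (s : Finset α) then 1 else 0
  | _, _ => 0

section Matches

variable {beats : P → P → Prop}

theorem mem_of_mem_ctcMatches {d i j : P} {xs : List P}
    (h : (i, j) ∈ ctcMatches beats d xs) : i ∈ d :: xs ∧ j ∈ d :: xs := by
  induction xs generalizing d with
  | nil => simp [ctcMatches] at h
  | cons x xs ih =>
    rw [ctcMatches] at h
    split_ifs at h <;> rcases List.mem_cons.1 h with h | h
    · simp_all
    · have := ih h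
      grind
    · simp_all
    · have := ih h
      grind

theorem winner_unique_of_mem_ctcMatches {d i i' j : P} {xs : List P} (hnd : (d :: xs).Nodup)
    (h : (i, j) ∈ ctcMatches beats d xs) (h' : (i', j) ∈ ctcMatches beats d xs) : i = i' := by
  induction xs generalizing d with
  | nil => simp [ctcMatches] at h
  | cons x xs ih =>
    rw [ctcMatches] at h h'
    split_ifs at h h' <;> rcases List.mem_cons.1 h with h | h <;>
      rcases List.mem_cons.1 h' with h' | h'
    all_goals
      first
      | grind
      | (have := mem_of_mem_ctcMatches h; grind)
      | (have := mem_of_mem_ctcMatches h'; grind)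

theorem winner_eq_of_mem_ctcMatches_of_top {c i j : P} (hc : ∀ x, x ≠ c → beats c x)
    {xs : List P} (hnd : (c :: xs).Nodup) (h : (i, j) ∈ ctcMatches beats c xs) : i = c := by
  induction xs with
  | nil => simp [ctcMatches] at h
  | cons x xs ih =>
    rw [ctcMatches, if_pos (hc x (by grind))] at h
    grind

theorem eq_of_winner_of_loses_to_top {c : P} (hc : ∀ x, x ≠ c → beats c x)
    {d : P} {xs : List P} (hnd : (d :: xs).Nodup)
    {a a' : P} (ha : a ≠ c) (ha' : a' ≠ c)
    (h : (c, a) ∈ ctcMatches beats d xs) (h' : (c, a') ∈ ctcMatches beats d xs)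
    (hw : a = d ∨ ∃ x, (a, x) ∈ ctcMatches beats d xs)
    (hw' : a' = d ∨ ∃ x, (a', x) ∈ ctcMatches beats d xs) : a = a' := by
  induction xs generalizing d with
  | nil => simp [ctcMatches] at h
  | cons x xs ih =>
    have key : ∀ b, b ≠ c → (b = c ∨ ∃ x, (b, x) ∈ ctcMatches beats c xs) →
        (c :: xs).Nodup → False := by
      rintro b hb (hbc | ⟨y, hy⟩) hn
      · exact hb hbc
      · exact hb (winner_eq_of_mem_ctcMatches_of_top hc hn hy)
    rw [ctcMatches] at h h' hw hw'
    split_ifs at h h' hw hw' with hdx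
    · by_cases hdc : d = c
      · subst hdc
        refine (key a ha ?_ (by grind)).elim
        grind
      · apply ih (d := d) <;> grind
    · by_cases hxc : x = c
      · subst hxc
        have : ∀ b, b ≠ x → (b = d ∨ ∃ y, (b, y) ∈ (x, d) :: ctcMatches beats x xs) → b = d := by
          intro b hb hw
          have := key b hb
          grind
        rw [this a ha hw, this a' ha' hw']
      · have had : ∀ b, (c, b) ∈ (x, d) :: ctcMatches beats x xs →
            (b = d ∨ ∃ y, (b, y) ∈ (x, d) :: ctcMatches beats x xs) →
            (c, b) ∈ ctcMatches beats x xs ∧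
              (b = x ∨ ∃ y, (b, y) ∈ ctcMatches beats x xs) := by
          intro b h hw
          have h1 : (c, b) ∈ ctcMatches beats x xs := by grind
          have := mem_of_mem_ctcMatches h1
          grind
        exact ih (d := x) (by grind) (had a h hw).1 (had a' h' hw').1 (had a h hw).2
          (had a' h' hw').2

theorem ctcMatches_append_of_forall_beats {d : P} {xs : List P} (ys : List P)
    (h : ∀ x ∈ xs, beats d x) :
    ctcMatches beats d (xs ++ ys) = xs.map (Prod.mk d) ++ ctcMatches beats d ys := by
  induction xs with
  | nil => rfl
  | cons x xs ih => simp_all [ctcMatches]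

theorem mem_ctcMatches_of_increasing_blocks (hasymm : ∀ i j, beats i j → ¬ beats j i)
    {ι : Type*} (p : ι → P) (f : ι → List P) (hf : ∀ s, ∀ u ∈ f s, beats (p s) u)
    {c : P} (hcp : ∀ s, beats c (p s)) {R : List P} (hcR : ∀ r ∈ R, beats c r)
    (d : ι) (L : List ι) (hL : (d :: L).Pairwise fun s t => beats (p t) (p s)) :
    let M := ctcMatches beats (p d) (f d ++ (L.flatMap (fun s => p s :: f s) ++ c :: R))
    (∀ s ∈ d :: L, ∀ u ∈ f s, (p s, u) ∈ M) ∧ (∃ s ∈ d :: L, (c, p s) ∈ M) ∧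
      ∀ r ∈ R, (c, r) ∈ M := by
  induction L generalizing d with
  | nil =>
    have hR := ctcMatches_append_of_forall_beats [] hcR
    rw [List.append_nil] at hR
    simp [ctcMatches_append_of_forall_beats _ (hf d), ctcMatches, hasymm _ _ (hcp d), hR]
    grind
  | cons e L ih =>
    have hed : beats (p e) (p d) := by grind
    obtain ⟨h1, h2, h3⟩ := ih e (by grind)
    simp only [ctcMatches_append_of_forall_beats _ (hf d), List.flatMap_cons, List.cons_append,
      ctcMatches, if_neg (hasymm _ _ hed), List.append_assoc]
    grind

end Matches

theorem exists_equiv_ofFn_eq [Fintype P] {l : List P} (hnd : l.Nodup) (hmem : ∀ x, x ∈ l) :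
    ∃ σ : Fin (Fintype.card P) ≃ P, List.ofFn σ = l := by
  have hlen : Fintype.card P = l.length := by
    simpa using Fintype.card_congr (hnd.getEquivOfForallMemList l hmem).symm
  refine ⟨(finCongr hlen).trans (hnd.getEquivOfForallMemList l hmem), ?_⟩
  rw [List.ofFn_congr hlen]
  exact List.ofFn_get l

theorem exists_list_pairwise_of_total {ι : Type*} (r : ι → ι → Prop)
    (htot : ∀ i j, i ≠ j → r i j ∨ r j i) (htrans : ∀ i j k, r i j → r j k → r i k)
    (A : Finset ι) : ∃ L : List ι, L.Nodup ∧ (∀ i, i ∈ L ↔ i ∈ A) ∧ L.Pairwise r := by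
  have : Std.Total fun i j => i = j ∨ r i j := ⟨fun i j => by grind⟩
  have : IsTrans ι fun i j => i = j ∨ r i j := ⟨fun i j k => by grind⟩
  have hp := List.perm_insertionSort (fun i j => i = j ∨ r i j) A.toList
  have hnd := hp.nodup_iff.2 A.nodup_toList
  refine ⟨_, hnd, fun i => by rw [hp.mem_iff, mem_toList], ?_⟩
  exact hnd.imp₂ (by grind) (List.pairwise_insertionSort (fun i j => i = j ∨ r i j) A.toList)

theorem sum_pairValue3DM_eq {α : Type*} [DecidableEq α] (U : Finset α) (S : Finset (Finset α))
    (beats : (({s // s ∈ S} ⊕ {a // a ∈ U}) ⊕ Unit) →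
      (({s // s ∈ S} ⊕ {a // a ∈ U}) ⊕ Unit) → Prop) {k : ℕ}
    (σ : Fin k → (({s // s ∈ S} ⊕ {a // a ∈ U}) ⊕ Unit)) :
    ∑ i, ∑ j ∈ Mset beats σ i, pairValue3DM U S i j =
      #{p : {s // s ∈ S} × {a // a ∈ U} | p.2.1 ∈ p.1.1 ∧
        (Sum.inl (Sum.inl p.1), Sum.inl (Sum.inr p.2)) ∈ matchesOf beats σ} +
      #{s : {s // s ∈ S} | (Sum.inr (), Sum.inl (Sum.inl s)) ∈ matchesOf beats σ} := by
  simp only [Mset, sum_filter, Fintype.sum_sum_type, pairValue3DM, card_filter,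
    Fintype.sum_prod_type, ite_self, sum_const_zero, add_zero, zero_add, ite_and]
  simp only [univ_unique, sum_singleton, PUnit.default_eq_unit]
  refine congrArg₂ _ (sum_congr rfl fun s _ => sum_congr rfl fun a _ => ?_) rfl
  split_ifs <;> rfl

theorem card_eq_three_mul_of_inter {α : Type*} [DecidableEq α] {X Y Z s : Finset α} {k : ℕ}
    (hXY : Disjoint X Y) (hXZ : Disjoint X Z) (hYZ : Disjoint Y Z) (hs : s ⊆ X ∪ Y ∪ Z)
    (hX : #(s ∩ X) = k) (hY : #(s ∩ Y) = k) (hZ : #(s ∩ Z) = k) : #s = 3 * k := by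
  have h : s = s ∩ X ∪ s ∩ Y ∪ s ∩ Z := by
    rw [← inter_union_distrib_left, ← inter_union_distrib_left, inter_eq_left.2 hs]
  rw [h, card_union_of_disjoint, card_union_of_disjoint, hX, hY, hZ]
  · omega
  · exact hXY.mono inter_subset_right inter_subset_right
  · rw [disjoint_union_left]
    exact ⟨hXZ.mono inter_subset_right inter_subset_right,
      hYZ.mono inter_subset_right inter_subset_right⟩

theorem existsUnique_mem_of_cover {α : Type*} [DecidableEq α] {U : Finset α}
    {A : Finset (Finset α)} {k : ℕ} (hA : ∀ s ∈ A, s ⊆ U ∧ #s = k) (hU : #U = k * #A)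
    (hcov : ∀ a ∈ U, ∃ s ∈ A, a ∈ s) : ∀ a ∈ U, ∃! s, s ∈ A ∧ a ∈ s := by
  have hcount : ∑ a ∈ U, #{s ∈ A | a ∈ s} = ∑ s ∈ A, #{a ∈ U | a ∈ s} :=
    sum_card_bipartiteAbove_eq_sum_card_bipartiteBelow (fun a s => a ∈ s)
  have hk : ∑ s ∈ A, #{a ∈ U | a ∈ s} = ∑ _s ∈ A, k := by
    refine sum_congr rfl fun s hs => ?_
    rw [filter_mem_eq_inter, inter_eq_right.2 (hA s hs).1, (hA s hs).2]
  have hle : ∀ a ∈ U, 1 ≤ #{s ∈ A | a ∈ s} := by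
    intro a ha
    obtain ⟨s, hs, has⟩ := hcov a ha
    exact card_pos.2 ⟨s, by simp [hs, has]⟩
  have hsum : ∑ _a ∈ U, 1 = ∑ a ∈ U, #{s ∈ A | a ∈ s} := by
    rw [hcount, hk, sum_const, sum_const, smul_eq_mul, smul_eq_mul, mul_one, hU, mul_comm]
  intro a ha
  obtain ⟨s, hs⟩ := card_eq_one.1 ((sum_eq_sum_iff_of_le hle).1 hsum a ha).symm
  have hmem : ∀ t, (t ∈ A ∧ a ∈ t) ↔ t = s := fun t => by
    rw [← mem_filter (p := fun t => a ∈ t), hs, mem_singleton]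
  exact ⟨s, (hmem s).2 rfl, fun t ht => (hmem t).1 ht⟩

theorem exists_exactCover_of_card_le {α : Type*} [DecidableEq α] {n : ℕ} {U : Finset α}
    {S : Finset (Finset α)} (hS : ∀ s ∈ S, s ⊆ U ∧ #s = 3) (hU : #U = 3 * n)
    {T : Finset ({s // s ∈ S} × {a // a ∈ U})} {L : Finset {s // s ∈ S}}
    (hT : ∀ p ∈ T, p.2.1 ∈ p.1.1)
    (hinj : Set.InjOn Prod.snd (T : Set ({s // s ∈ S} × {a // a ∈ U})))
    (hLW : #L + #(T.image Prod.fst) ≤ #S + 1) (h : #S + 2 * n + 1 ≤ #T + #L) :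
    ∃ S' ⊆ S, #S' = n ∧ ∀ a ∈ U, ∃! s, s ∈ S' ∧ a ∈ s := by
  have hTW : #T ≤ 3 * #(T.image Prod.fst) := by
    refine card_le_mul_card_image T 3 fun s _ => ?_
    rw [← (hS s.1 s.2).2]
    refine card_le_card_of_injOn (fun p => p.2.1) ?_ ?_
    · rintro ⟨s', a⟩ h
      obtain ⟨hp, rfl⟩ := mem_filter.1 h
      exact hT _ hp
    · rintro ⟨s', a⟩ h ⟨s'', a'⟩ h' haa
      exact Prod.ext ((mem_filter.1 h).2.trans (mem_filter.1 h').2.symm) (Subtype.ext haa)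
  have hTU : #(T.image Prod.snd) = #T := card_image_of_injOn hinj
  have hTU' : #(T.image Prod.snd) ≤ 3 * n := by
    rw [← hU, ← Fintype.card_coe U]
    exact card_le_univ _
  set W : Finset {s // s ∈ S} := T.image Prod.fst
  have hWn : #W = n := by omega
  have hTn : #(T.image Prod.snd) = 3 * n := by omega
  have huniv : T.image Prod.snd = univ := by
    rw [← card_eq_iff_eq_univ, Fintype.card_coe, hTn, hU]
  have hWn' : #(W.image Subtype.val) = n := by
    rw [card_image_of_injective _ Subtype.val_injective, hWn]
  refine ⟨W.image Subtype.val, ?_, hWn', existsUnique_mem_of_cover (k := 3) ?_ ?_ ?_⟩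
  · intro s hs
    obtain ⟨s, -, rfl⟩ := mem_image.1 hs
    exact s.2
  · intro s hs
    obtain ⟨s, -, rfl⟩ := mem_image.1 hs
    exact hS s.1 s.2
  · rw [hU, hWn']
  · intro a ha
    have := huniv ▸ mem_univ (⟨a, ha⟩ : {a // a ∈ U})
    obtain ⟨⟨s, b⟩, hp, rfl⟩ := mem_image.1 this
    exact ⟨s.1, mem_image_of_mem _ (mem_image_of_mem _ hp), hT _ hp⟩

theorem exists_seeding_of_exactCover {α : Type*} [DecidableEq α] {n : ℕ} (hn : 1 ≤ n)
    {U : Finset α} {S : Finset (Finset α)} (hU3 : #U = 3 * n)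
    {beats : (({s // s ∈ S} ⊕ {a // a ∈ U}) ⊕ Unit) →
      (({s // s ∈ S} ⊕ {a // a ∈ U}) ⊕ Unit) → Prop}
    (hasymm : ∀ i j, beats i j → ¬ beats j i)
    (htot : ∀ i j, i ≠ j → (beats i j ↔ ¬ beats j i))
    (htrans : ∀ i j l, beats i j → beats j l → beats i l)
    (hc : ∀ x, x ≠ Sum.inr () → beats (Sum.inr ()) x)
    (hSa : ∀ (s : {s // s ∈ S}) (a : {a // a ∈ U}),
      beats (Sum.inl (Sum.inl s)) (Sum.inl (Sum.inr a)))
    {A : Finset (Finset α)} (hAS : A ⊆ S) (hAn : #A = n)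
    (hA : ∀ a ∈ U, ∃! s, s ∈ A ∧ a ∈ s) :
    ∃ σ : Fin (Fintype.card (({s // s ∈ S} ⊕ {a // a ∈ U}) ⊕ Unit)) ≃
        (({s // s ∈ S} ⊕ {a // a ∈ U}) ⊕ Unit),
      #S + 2 * n + 1 ≤ ∑ i, ∑ j ∈ Mset beats (⇑σ) i, pairValue3DM U S i j := by
  simp only [sum_pairValue3DM_eq]
  obtain ⟨L, hLnd, hLmem, hLp⟩ := exists_list_pairwise_of_total
    (fun s t : {s // s ∈ S} => beats (Sum.inl (Sum.inl t)) (Sum.inl (Sum.inl s)))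
    (fun s t hst => by
      have := htot (Sum.inl (Sum.inl s)) (Sum.inl (Sum.inl t)) (by simpa using hst)
      tauto)
    (fun s t u h h' => htrans _ _ _ h' h) {s | s.1 ∈ A}
  simp only [mem_filter, mem_univ, true_and] at hLmem
  have hLn : L.length = n := by
    rw [← List.toFinset_card_of_nodup hLnd, ← hAn]
    refine card_nbij Subtype.val ?_ Subtype.val_injective.injOn ?_
    · intro s hs
      simpa [hLmem] using hs
    · intro s hs
      exact ⟨⟨s, hAS hs⟩, by simpa [hLmem] using hs, rfl⟩
  obtain ⟨d, L, rfl⟩ : ∃ d L', L = d :: L' := List.exists_cons_of_length_pos (by omega)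
  let p : {s // s ∈ S} → (({s // s ∈ S} ⊕ {a // a ∈ U}) ⊕ Unit) := fun s => Sum.inl (Sum.inl s)
  let b : {a // a ∈ U} → (({s // s ∈ S} ⊕ {a // a ∈ U}) ⊕ Unit) := fun a => Sum.inl (Sum.inr a)
  let f : {s // s ∈ S} → List (({s // s ∈ S} ⊕ {a // a ∈ U}) ⊕ Unit) := fun s =>
    ({a : {a // a ∈ U} | a.1 ∈ s.1} : Finset {a // a ∈ U}).toList.map b
  let R := ({s : {s // s ∈ S} | s.1 ∉ A} : Finset {s // s ∈ S}).toList.map p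
  have hp : Function.Injective p := fun s t h => by simpa [p] using h
  have hb : Function.Injective b := fun s t h => by simpa [b] using h
  have hf : ∀ s x, x ∈ f s ↔ ∃ a : {a // a ∈ U}, a.1 ∈ s.1 ∧ b a = x := by simp [f]
  have hR : ∀ x, x ∈ R ↔ ∃ s : {s // s ∈ S}, s.1 ∉ A ∧ p s = x := by
    simp only [R, List.mem_map, mem_toList, mem_filter, mem_univ, true_and, implies_true]
  obtain ⟨h1, ⟨e, he, h2⟩, h3⟩ := mem_ctcMatches_of_increasing_blocks hasymm p f
    (fun s u hu => by obtain ⟨a, _, rfl⟩ := (hf s u).1 hu; exact hSa s a)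
    (c := Sum.inr ()) (fun s => hc _ (by simp [p])) (R := R)
    (fun r hr => by obtain ⟨s, _, rfl⟩ := (hR r).1 hr; exact hc _ (by simp [p])) d L hLp
  obtain ⟨σ, hσ⟩ := exists_equiv_ofFn_eq
    (l := (d :: L).flatMap (fun s => p s :: f s) ++ Sum.inr () :: R) (by
      have hfnd : ∀ s, (p s :: f s).Nodup := fun s => by
        refine List.nodup_cons.2 ⟨?_, (nodup_toList _).map hb⟩
        simp [hf, p, b]
      have hRnd : (Sum.inr () :: R).Nodup := by
        refine List.nodup_cons.2 ⟨?_, (nodup_toList _).map hp⟩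
        simp [hR, p]
      refine List.nodup_append.2 ⟨List.nodup_flatMap.2 ⟨fun s _ => hfnd s, ?_⟩, hRnd, ?_⟩
      · refine hLnd.imp_of_mem fun {s t} hs ht hst x hx hx' => ?_
        rw [List.mem_cons, hf] at hx hx'
        rcases hx with rfl | ⟨a, ha, rfl⟩ <;> rcases hx' with hx' | ⟨a', ha', hx'⟩
        · exact hst (hp hx')
        · simp [p, b] at hx'
        · simp [p, b] at hx'
        · obtain rfl := hb hx'
          exact hst (Subtype.ext ((hA _ a'.2).unique ⟨(hLmem s).1 hs, ha⟩
            ⟨(hLmem t).1 ht, ha'⟩))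
      · rintro x hx y hy rfl
        obtain ⟨s, hs, hx⟩ := List.mem_flatMap.1 hx
        rw [List.mem_cons, hf] at hx
        rw [List.mem_cons, hR] at hy
        rcases hx with rfl | ⟨a, ha, rfl⟩ <;> rcases hy with hy | ⟨t, ht, hy⟩
        · simp [p] at hy
        · exact ht (hp hy ▸ (hLmem s).1 hs)
        · simp [b] at hy
        · simp [p, b] at hy) (by
      intro x
      rw [List.mem_append, List.mem_flatMap, List.mem_cons, hR]
      rcases x with (s | a) | _
      · by_cases hs : s.1 ∈ A
        · exact Or.inl ⟨s, (hLmem s).2 hs, List.mem_cons_self⟩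
        · exact Or.inr (Or.inr ⟨s, hs, rfl⟩)
      · obtain ⟨s, ⟨hs, has⟩, _⟩ := hA a a.2
        exact Or.inl ⟨⟨s, hAS hs⟩, (hLmem _).2 hs,
          List.mem_cons_of_mem _ ((hf _ _).2 ⟨a, has, rfl⟩)⟩
      · exact Or.inr (Or.inl rfl))
  refine ⟨σ, ?_⟩
  have hM : matchesOf beats σ = ctcMatches beats (p d)
      (f d ++ (L.flatMap (fun s => p s :: f s) ++ Sum.inr () :: R)) := by
    rw [matchesOf, hσ]
    simp [ctcMatchesL]
  rw [← hM] at h1 h2 h3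
  generalize matchesOf beats σ = M at *
  have hT : 3 * n ≤ #{p : {s // s ∈ S} × {a // a ∈ U} | p.2.1 ∈ p.1.1 ∧
      (Sum.inl (Sum.inl p.1), Sum.inl (Sum.inr p.2)) ∈ M} := by
    rw [← hU3, ← Fintype.card_coe U, ← card_univ]
    refine card_le_card_of_surjOn Prod.snd fun a _ => ?_
    obtain ⟨s, ⟨hs, has⟩, _⟩ := hA a a.2
    refine ⟨(⟨s, hAS hs⟩, a), ?_, rfl⟩
    simp only [coe_filter, mem_univ, true_and, Set.mem_ofPred_eq]
    exact ⟨has, h1 _ ((hLmem _).2 hs) _ ((hf _ _).2 ⟨a, has, rfl⟩)⟩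
  have hC : #S + 1 ≤ n + #{s : {s // s ∈ S} | (Sum.inr (), Sum.inl (Sum.inl s)) ∈ M} := by
    have hsub : insert e ({s : {s // s ∈ S} | s.1 ∉ A} : Finset {s // s ∈ S}) ⊆
        ({s : {s // s ∈ S} | (Sum.inr (), Sum.inl (Sum.inl s)) ∈ M} : Finset {s // s ∈ S}) := by
      intro s hs
      rw [mem_insert, mem_filter] at hs
      rw [mem_filter]
      rcases hs with rfl | hs
      · exact ⟨mem_univ _, h2⟩
      · exact ⟨mem_univ _, h3 _ ((hR _).2 ⟨s, hs.2, rfl⟩)⟩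
    have hcard := card_le_card hsub
    rw [card_insert_of_notMem (by simpa using (hLmem e).1 he)] at hcard
    have hcompl := card_filter_add_card_filter_not (s := (univ : Finset {s // s ∈ S}))
      (fun s => s.1 ∈ A)
    have hLA : ({s : {s // s ∈ S} | s.1 ∈ A} : Finset {s // s ∈ S}) = (d :: L).toFinset := by
      ext s
      simp [← hLmem]
    rw [hLA, List.toFinset_card_of_nodup hLnd, hLn, card_univ, Fintype.card_coe] at hcompl
    omega
  omega

/-- Hardness reduction for binary pair-based values on a DAG strength graph: given
a 3-Dimensional Matching instance (`X`, `Y`, `Z` pairwise disjoint of size `n`,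
`𝒰 = X ∪ Y ∪ Z`, `𝒮` a family of `m` subsets of `𝒰` meeting each of `X`, `Y`, `Z`
in exactly one element), take a set player `a_S` for each `S ∈ 𝒮`, an element
player `b_u` for each `u ∈ 𝒰`, and one further player `c`, with `beats` any strict
total order in which `c` beats everyone and each `a_S` beats each `b_u`.  With the
pair values `pairValue3DM`, some seeding attains pair-based value at least
`m + 2n + 1` iff the instance has a perfect 3-dimensional matching. -/
theorem ctc_dag_pair_value_reduction {α : Type*} [DecidableEq α]
    (n : ℕ) (hn : 1 ≤ n) (X Y Z : Finset α)
    (hXY : Disjoint X Y) (hXZ : Disjoint X Z) (hYZ : Disjoint Y Z)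
    (hX : X.card = n) (hY : Y.card = n) (hZ : Z.card = n)
    (U : Finset α) (hU : U = X ∪ Y ∪ Z)
    (S : Finset (Finset α))
    (hS : ∀ s ∈ S, s ⊆ U ∧ (s ∩ X).card = 1 ∧ (s ∩ Y).card = 1 ∧ (s ∩ Z).card = 1)
    (beats : (({s // s ∈ S} ⊕ {a // a ∈ U}) ⊕ Unit) →
             (({s // s ∈ S} ⊕ {a // a ∈ U}) ⊕ Unit) → Prop)
    (hirr : ∀ i, ¬ beats i i)
    (htot : ∀ i j, i ≠ j → (beats i j ↔ ¬ beats j i))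
    (htrans : ∀ i j l, beats i j → beats j l → beats i l)
    (hc : ∀ x, x ≠ Sum.inr () → beats (Sum.inr ()) x)
    (hSa : ∀ (s : {s // s ∈ S}) (a : {a // a ∈ U}),
      beats (Sum.inl (Sum.inl s)) (Sum.inl (Sum.inr a))) :
    (∃ σ : Fin (Fintype.card (({s // s ∈ S} ⊕ {a // a ∈ U}) ⊕ Unit)) ≃
        (({s // s ∈ S} ⊕ {a // a ∈ U}) ⊕ Unit),
      S.card + 2 * n + 1 ≤
        ∑ i, ∑ j ∈ Mset beats (⇑σ) i, pairValue3DM U S i j) ↔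
    (∃ S' ⊆ S, S'.card = n ∧ ∀ a ∈ U, ∃! s, s ∈ S' ∧ a ∈ s) := by
  have hasymm : ∀ i j, beats i j → ¬ beats j i := fun i j h h' => hirr i (htrans i j i h h')
  have hS3 : ∀ s ∈ S, #s = 3 := fun s hs => by
    obtain ⟨h, h1, h2, h3⟩ := hS s hs
    exact card_eq_three_mul_of_inter hXY hXZ hYZ (hU ▸ h) h1 h2 h3
  have hU3 : #U = 3 * n := by
    apply card_eq_three_mul_of_inter hXY hXZ hYZ hU.subset <;>
      rw [inter_eq_right.2] <;> first | assumption | (rw [hU]; grind)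
  constructor
  · rintro ⟨σ, hσ⟩
    rw [sum_pairValue3DM_eq] at hσ
    have hnd : (List.ofFn σ).Nodup := List.nodup_ofFn.2 σ.injective
    have huniq : ∀ i i' j, (i, j) ∈ matchesOf beats σ → (i', j) ∈ matchesOf beats σ →
        i = i' := by
      rw [matchesOf]
      cases hl : List.ofFn σ with
      | nil => simp [ctcMatchesL]
      | cons d xs => exact fun i i' j => winner_unique_of_mem_ctcMatches (hl ▸ hnd)
    have htop : ∀ a a', a ≠ Sum.inr () → a' ≠ Sum.inr () →
        (Sum.inr (), a) ∈ matchesOf beats σ → (Sum.inr (), a') ∈ matchesOf beats σ →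
        (∃ x, (a, x) ∈ matchesOf beats σ) → (∃ x, (a', x) ∈ matchesOf beats σ) → a = a' := by
      rw [matchesOf]
      cases hl : List.ofFn σ with
      | nil => simp [ctcMatchesL]
      | cons d xs =>
        exact fun a a' ha ha' h h' hw hw' =>
          eq_of_winner_of_loses_to_top hc (hl ▸ hnd) ha ha' h h' (Or.inr hw) (Or.inr hw')
    generalize matchesOf beats σ = M at *
    refine exists_exactCover_of_card_le (fun s hs => ⟨(hS s hs).1, hS3 s hs⟩) hU3
      (fun p hp => (mem_filter.1 hp).2.1) ?_ ?_ hσ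
    · rintro ⟨s, a⟩ h ⟨s', a'⟩ h' (rfl : a = a')
      have := huniq _ _ _ (mem_filter.1 h).2.2 (mem_filter.1 h').2.2
      exact Prod.ext (Sum.inl_injective (Sum.inl_injective this)) rfl
    · rw [← card_union_add_card_inter, ← Fintype.card_coe S]
      refine add_le_add (card_le_univ _) (card_le_one.2 fun s hs s' hs' => ?_)
      simp only [mem_inter, mem_filter, mem_univ, true_and, mem_image] at hs hs'
      obtain ⟨h, ⟨_, a⟩, ⟨_, h1⟩, rfl⟩ := hs
      obtain ⟨h', ⟨_, a'⟩, ⟨_, h1'⟩, rfl⟩ := hs'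
      have := htop _ _ (by simp) (by simp) h h' ⟨_, h1⟩ ⟨_, h1'⟩
      simpa using this
  · rintro ⟨A, hAS, hAn, hA⟩
    exact exists_seeding_of_exactCover hn hU3 hasymm htot htrans hc hSa hAS hAn hA
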